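/- Let k be a field, let N ≥ n ≥ 1, and let γ_1, …, γ_N be linear forms in k[x_1,…,x_n] which are n-independent, i.e., any n of them are linearly independent. Let I_n be the ideal generated by the products of all γ_j with j outside {i_1,…,i_{n−1}}, over all sequences 1 ≤ i_1 < ⋯ < i_{n−1} ≤ N. Then every homogeneous polynomial of degree m > N − n in k[x_1,…,x_n] belongs to I_n. -/

import Mathlib

open MvPolynomial Finset

/-- The linear form in `k[x_1,…,x_n]` corresponding to a covector with coefficients `w`. -/
noncomputable def linForm {R : Type*} [CommSemiring R] {n : ℕ} (w : Fin n → R) :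
    MvPolynomial (Fin n) R :=
  ∑ i, MvPolynomial.C (w i) * MvPolynomial.X i

/-- A family of vectors is `l`-independent if every `l` of them are linearly independent. -/
def LIndep {k : Type*} [Field k] {n N : ℕ} (γ : Fin N → Fin n → k) (l : ℕ) : Prop :=
  ∀ s : Finset (Fin N), s.card = l → LinearIndependent k (fun i : {x // x ∈ s} => γ i.1)

/-- The ideal `I_l` generated by the products of all `γ_j` with `j` outside a set of `l - 1`
indices. -/
noncomputable def omittingIdeal {k : Type*} [Field k] {n N : ℕ} (γ : Fin N → Fin n → k)
    (l : ℕ) : Ideal (MvPolynomial (Fin n) k) :=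
  Ideal.span {g | ∃ T : Finset (Fin N), T.card = l - 1 ∧ g = ∏ j ∈ Tᶜ, linForm (γ j)}

theorem linForm_eq_linearCombination {R : Type*} [CommSemiring R] {n : ℕ} (w : Fin n → R) :
    linForm w = Fintype.linearCombination R (X : Fin n → MvPolynomial (Fin n) R) w := by
  simp [linForm, Fintype.linearCombination_apply, smul_eq_C_mul]

theorem linForm_single {R : Type*} [CommSemiring R] {n : ℕ} (i : Fin n) :
    linForm (Pi.single i (1 : R)) = X i := by
  simp [linForm_eq_linearCombination, Fintype.linearCombination_apply_single]

/-- If the covectors `w` span the dual space, the corresponding linear forms generate the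
ideal of the origin. -/
theorem idealOfVars_le_span_linForm {R ι : Type*} [CommRing R] {n : ℕ} {w : ι → Fin n → R}
    (hw : Submodule.span R (Set.range w) = ⊤) :
    idealOfVars (Fin n) R ≤ Ideal.span (Set.range fun i => linForm (w i)) := by
  rw [Ideal.span_le]
  rintro _ ⟨i, rfl⟩
  have h : ∀ v ∈ Submodule.span R (Set.range w),
      linForm v ∈ Ideal.span (Set.range fun i => linForm (w i)) := by
    intro v hv
    induction hv using Submodule.span_induction with
    | mem v hv =>
      obtain ⟨j, rfl⟩ := hv
      exact Ideal.subset_span ⟨j, rfl⟩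
    | zero => simp [linForm]
    | add u v _ _ hu hv =>
      rw [linForm_eq_linearCombination] at hu hv ⊢
      rw [map_add]
      exact add_mem hu hv
    | smul c v _ hv =>
      rw [linForm_eq_linearCombination] at hv ⊢
      rw [map_smul, smul_eq_C_mul]
      exact Ideal.mul_mem_left _ _ hv
  rw [← linForm_single]
  exact h _ (hw ▸ Submodule.mem_top)

/-- The product of more than `N - l` distinct forms lies in `I_l`. -/
theorem prod_linForm_mem_omittingIdeal {k : Type*} [Field k] {n N l : ℕ}
    (γ : Fin N → Fin n → k) (hl : 1 ≤ l) (hlN : l ≤ N) {s : Finset (Fin N)}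
    (hs : N - l < s.card) : ∏ j ∈ s, linForm (γ j) ∈ omittingIdeal γ l := by
  obtain ⟨t, hts, ht⟩ := Finset.exists_subset_card_eq (Nat.succ_le_of_lt hs)
  refine Ideal.mem_of_dvd _ (Finset.prod_dvd_prod_of_subset _ _ _ hts) ?_
  refine Ideal.subset_span ⟨tᶜ, ?_, by rw [compl_compl]⟩
  rw [Finset.card_compl, Fintype.card_fin]
  omega

/-- If the forms are `n`-independent, the product of `s.card` distinct forms with an element of
the `r`-th power of the ideal of the origin lies in `I_n` once `s.card + r > N - n`. -/
theorem prod_linForm_mul_mem_omittingIdeal {k : Type*} [Field k] {n N : ℕ} (hn : 1 ≤ n)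
    (hN : n ≤ N) (γ : Fin N → Fin n → k) (hind : LIndep γ n) (r : ℕ) :
    ∀ s : Finset (Fin N), N - n < s.card + r → ∀ f ∈ idealOfVars (Fin n) k ^ r,
      (∏ j ∈ s, linForm (γ j)) * f ∈ omittingIdeal γ n := by
  induction r with
  | zero =>
    intro s hs f _
    exact Ideal.mul_mem_right _ _ (prod_linForm_mem_omittingIdeal γ hn hN hs)
  | succ r ih =>
    intro s hs f hf
    by_cases hcard : N - n < s.card
    · exact Ideal.mul_mem_right _ _ (prod_linForm_mem_omittingIdeal γ hn hN hcard)
    have hcompl : n ≤ sᶜ.card := by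
      rw [Finset.card_compl, Fintype.card_fin]
      omega
    obtain ⟨B, hB, hBcard⟩ := Finset.exists_subset_card_eq hcompl
    have hspan := (hind B hBcard).span_eq_top_of_card_eq_finrank' (by simp [hBcard])
    rw [pow_succ'] at hf
    induction hf using Submodule.mul_induction_on' with
    | mem_mul_mem p hp q hq =>
      replace hp := idealOfVars_le_span_linForm hspan hp
      induction hp using Submodule.span_induction with
      | mem p hp =>
        obtain ⟨⟨b, hb⟩, rfl⟩ := hp
        have hbs : b ∉ s := Finset.mem_compl.mp (hB hb)
        have := ih (insert b s) (by rw [Finset.card_insert_of_notMem hbs]; omega) q hq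
        rwa [Finset.prod_insert hbs, mul_comm (linForm (γ b)), mul_assoc] at this
      | zero => simp
      | add x y _ _ hx hy =>
        rw [add_mul, mul_add]
        exact add_mem hx hy
      | smul c x _ hx =>
        rw [smul_eq_mul, mul_assoc, mul_left_comm]
        exact Ideal.mul_mem_left _ _ hx
    | add x _ y _ hx hy =>
      rw [mul_add]
      exact add_mem hx hy

/-- **Lemma 2.4, second assertion.** Let `k` be a field, `N ≥ n ≥ 1`, and let `γ_1, …, γ_N`
be `n`-independent linear forms in `k[x_1,…,x_n]`.  Then every homogeneous polynomial of
degree `m > N - n` belongs to the ideal `I_n`. -/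
theorem omittingIdeal_contains_high_degrees
    {k : Type*} [Field k] (n N : ℕ) (hn : 1 ≤ n) (hN : n ≤ N)
    (γ : Fin N → Fin n → k) (hind : LIndep γ n) :
    ∀ m : ℕ, N - n < m → ∀ f : MvPolynomial (Fin n) k,
      f.IsHomogeneous m → f ∈ omittingIdeal γ n := by
  intro m hm f hf
  have hpow : f ∈ idealOfVars (Fin n) k ^ m := by
    rw [mem_pow_idealOfVars_iff]
    intro d hd
    rw [Finsupp.degree_eq_weight_one]
    exact (hf (mem_support_iff.mp hd)).ge
  simpa using prod_linForm_mul_mem_omittingIdeal hn hN γ hind m ∅ (by simpa using hm) f hpow
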